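/- Let X be a uniformly convex and uniformly smooth real Banach space whose moduli of smoothness and convexity are both of power type. Let A ⊂ X be proximally smooth with constant R > 0, and let x0, x1 ∈ A satisfy ‖x0 − x1‖/R < 2. Then there exists a rectifiable curve in A with endpoints x0 and x1. -/

import Mathlib

noncomputable section

open Set Metric

/-- The modulus of smoothness of a normed space `X`. -/
def modSmooth (X : Type*) [NormedAddCommGroup X] [NormedSpace ℝ X] (τ : ℝ) : ℝ :=
  sSup {r : ℝ | ∃ x y : X, ‖x‖ = 1 ∧ ‖y‖ = τ ∧ r = (‖x + y‖ + ‖x - y‖) / 2 - 1}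

/-- `X` is uniformly smooth: `ρ_X(τ)/τ → 0` as `τ → 0⁺`. -/
def UnifSmooth (X : Type*) [NormedAddCommGroup X] [NormedSpace ℝ X] : Prop :=
  Filter.Tendsto (fun τ => modSmooth X τ / τ) (nhdsWithin 0 (Set.Ioi 0)) (nhds 0)

/-- The modulus of convexity of a normed space `X`. -/
def modConvex (X : Type*) [NormedAddCommGroup X] [NormedSpace ℝ X] (ε : ℝ) : ℝ :=
  sInf {r : ℝ | ∃ x y : X, ‖x‖ ≤ 1 ∧ ‖y‖ ≤ 1 ∧ ε ≤ ‖x - y‖ ∧ r = 1 - ‖x + y‖ / 2}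

/-- A closed set `A` is proximally smooth with constant `R` if the distance function
is continuously (Fréchet) differentiable on the open `R`-neighborhood of `A`. -/
def ProximallySmooth {X : Type*} [NormedAddCommGroup X] [NormedSpace ℝ X]
    (A : Set X) (R : ℝ) : Prop :=
  IsClosed A ∧ ContDiffOn ℝ 1 (fun x => Metric.infDist x A)
    {x : X | 0 < Metric.infDist x A ∧ Metric.infDist x A < R}

/-- `y` is quasi-orthogonal to `x`: `‖x + λ y‖ ≥ ‖x‖` for all real `λ`
(Birkhoff--James orthogonality of `x` to `y`). -/
def QuasiOrth {X : Type*} [NormedAddCommGroup X] [NormedSpace ℝ X] (y x : X) : Prop :=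
  ∀ l : ℝ, ‖x‖ ≤ ‖x + l • y‖

/-- `ζ_X^+(ε) = sup{‖x + ε y‖ : ‖x‖ = ‖y‖ = 1, y ⌐ x}`. -/
def zetaPlus (X : Type*) [NormedAddCommGroup X] [NormedSpace ℝ X] (ε : ℝ) : ℝ :=
  sSup {r : ℝ | ∃ x y : X, ‖x‖ = 1 ∧ ‖y‖ = 1 ∧ QuasiOrth y x ∧ r = ‖x + ε • y‖}

/-- `ω_X(τ) = ρ_X(τ)/τ`. -/
def omegaX (X : Type*) [NormedAddCommGroup X] [NormedSpace ℝ X] (τ : ℝ) : ℝ :=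
  modSmooth X τ / τ

/-- The inverse function of `ω_X`. -/
def omegaInv (X : Type*) [NormedAddCommGroup X] [NormedSpace ℝ X] : ℝ → ℝ :=
  Function.invFun (omegaX X)

/-- The inverse function of `ζ_X^+`. -/
def zetaPlusInv (X : Type*) [NormedAddCommGroup X] [NormedSpace ℝ X] : ℝ → ℝ :=
  Function.invFun (zetaPlus X)

/-- `R′(τ, R) = 8R·ρ_X(τ/R)/(1 − 8 ω_X(τ/R))`. -/
def Rprime (X : Type*) [NormedAddCommGroup X] [NormedSpace ℝ X] (τ R : ℝ) : ℝ :=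
  8 * R * modSmooth X (τ / R) / (1 - 8 * omegaX X (τ / R))

/-- The metric projection of `x` onto `A`. -/
def metricProj {X : Type*} [NormedAddCommGroup X] [NormedSpace ℝ X]
    (A : Set X) (x : X) : Set X :=
  {a : X | a ∈ A ∧ ‖a - x‖ = Metric.infDist x A}

/-- The metric projection of the segment `[x0, x1]` onto `A`. -/
def metricProjSeg {X : Type*} [NormedAddCommGroup X] [NormedSpace ℝ X]
    (A : Set X) (x0 x1 : X) : Set X :=
  ⋃ x ∈ segment ℝ x0 x1, metricProj A x

/-- A slice-projection of the midpoint of `[x0, x1]` onto `A`. -/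
def IsSliceProj {X : Type*} [NormedAddCommGroup X] [NormedSpace ℝ X]
    (A : Set X) (x0 x1 z : X) : Prop :=
  z ∈ metricProjSeg A x0 x1 ∧ QuasiOrth (z - midpoint ℝ x0 x1) (x0 - x1)

/-- `f` parametrizes a curve in `A` with endpoints `x0` and `x1`. -/
def IsCurveIn {X : Type*} [NormedAddCommGroup X] [NormedSpace ℝ X]
    (A : Set X) (x0 x1 : X) (f : ℝ → X) : Prop :=
  ContinuousOn f (Set.Icc 0 1) ∧ f 0 = x0 ∧ f 1 = x1 ∧ f '' Set.Icc 0 1 ⊆ A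


theorem aux_slope {X : Type*} [NormedAddCommGroup X] [NormedSpace ℝ X] {A : Set X} {x : X}
    {φ : X →L[ℝ] ℝ} (hφ : HasFDerivAt (fun x => Metric.infDist x A) φ x) {ε : ℝ} (hε : 0 < ε) :
    ∃ η > 0, ∀ a ∈ A, ‖x - a‖ ≤ Metric.infDist x A + η → Metric.infDist x A - ε ≤ φ (x - a) := by
  have hd : 0 ≤ Metric.infDist x A := Metric.infDist_nonneg
  set d := Metric.infDist x A with hd_def
  have hc : 0 < ε / (2 * (d + 1)) := by positivity
  have h1 := (hasFDerivAt_iff_isLittleO_nhds_zero.1 hφ).def hc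
  obtain ⟨r, hr, h2⟩ := Metric.eventually_nhds_iff.1 h1
  set τ := min (1/2) (r / (2 * (d + 1))) with hτ
  have hτ0 : 0 < τ := by positivity
  have hτ1 : τ ≤ 1/2 := min_le_left _ _
  have hτr : τ * (d + 1) < r := by
    have : τ ≤ r / (2 * (d + 1)) := min_le_right _ _
    rw [le_div_iff₀ (by positivity)] at this
    nlinarith
  refine ⟨min 1 (τ * ε / 2), by positivity, fun a ha h => ?_⟩
  have hη1 : min 1 (τ * ε / 2) ≤ 1 := min_le_left _ _
  have hη2 : min 1 (τ * ε / 2) ≤ τ * ε / 2 := min_le_right _ _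
  set η := min 1 (τ * ε / 2)
  have hv : ‖τ • (a - x)‖ ≤ τ * (d + 1) := by
    rw [norm_smul, Real.norm_of_nonneg hτ0.le, norm_sub_rev]
    gcongr
    linarith
  have h3 := @h2 (τ • (a - x)) (by rw [dist_zero_right]; linarith)
  rw [Real.norm_eq_abs] at h3
  have h4 := (abs_le.1 h3).1
  have h5 : Metric.infDist (x + τ • (a - x)) A ≤ (1 - τ) * ‖x - a‖ := by
    have := Metric.infDist_le_dist_of_mem (x := x + τ • (a - x)) ha
    rw [dist_eq_norm] at this
    have e : x + τ • (a - x) - a = (1 - τ) • (x - a) := by module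
    rwa [e, norm_smul, Real.norm_of_nonneg (by linarith)] at this
  have h6 : ε / (2 * (d + 1)) * ‖τ • (a - x)‖ ≤ τ * ε / 2 := by
    calc _ ≤ ε / (2 * (d + 1)) * (τ * (d + 1)) := by gcongr
      _ = _ := by field_simp
  have h7 : φ (τ • (a - x)) = - (τ * φ (x - a)) := by
    rw [map_smul, ← neg_sub x a, map_neg, smul_eq_mul]; ring
  rw [h7] at h4
  have h8 : (1 - τ) * ‖x - a‖ ≤ (1 - τ) * (d + η) := by
    apply mul_le_mul_of_nonneg_left h; linarith
  have h9 : τ * (d - ε) ≤ τ * φ (x - a) := by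
    have : 0 < η := by positivity
    nlinarith
  exact le_of_mul_le_mul_left h9 hτ0

theorem aux_ascent {X : Type*} [NormedAddCommGroup X] [NormedSpace ℝ X] {A : Set X} (hA : A.Nonempty)
    {x : X} (hx : DifferentiableAt ℝ (fun x => Metric.infDist x A) x) (hd : 0 < Metric.infDist x A)
    {ε : ℝ} (hε : 0 < ε) (hε1 : ε < 1) {r : ℝ} (hr : 0 < r) :
    ∃ y, ‖y - x‖ < r ∧ Metric.infDist x A < Metric.infDist y A ∧
      (1 - ε) * ‖y - x‖ ≤ Metric.infDist y A - Metric.infDist x A := by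
  have hφ := hx.hasFDerivAt
  set φ := fderiv ℝ (fun x => Metric.infDist x A) x
  set d := Metric.infDist x A with hd_def
  obtain ⟨η, hη, h1⟩ := aux_slope hφ (ε := ε * d / 8) (by positivity)
  obtain ⟨a, ha, hax⟩ := (Metric.infDist_lt_iff (x := x) (r := d + min η (ε * d / 8)) hA).1
    (by have : 0 < min η (ε * d / 8) := by positivity
        linarith)
  rw [dist_eq_norm] at hax
  have hm1 := min_le_left η (ε * d / 8)
  have hm2 := min_le_right η (ε * d / 8)
  have h2 := h1 a ha (by linarith)
  have h3 : (1 - ε / 2) * ‖x - a‖ ≤ φ (x - a) := by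
    have e1 : (1 - ε / 2) * ‖x - a‖ ≤ (1 - ε / 2) * (d + ε * d / 8) := by
      apply mul_le_mul_of_nonneg_left <;> linarith
    have e2 : 0 ≤ ε * ε * d := by positivity
    have e3 : 0 ≤ ε * d := by positivity
    rw [← hd_def] at h2
    nlinarith
  have hpos : 0 < ‖x - a‖ := by
    have := Metric.infDist_le_dist_of_mem (x := x) ha
    rw [dist_eq_norm] at this
    linarith
  have h4 := (hasFDerivAt_iff_isLittleO_nhds_zero.1 hφ).def (c := ε / 2) (by positivity)
  obtain ⟨ρ, hρ, h5⟩ := Metric.eventually_nhds_iff.1 h4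
  set σ := min r ρ / (2 * ‖x - a‖) with hσ
  have hσ0 : 0 < σ := by positivity
  have hn : ‖σ • (x - a)‖ = min r ρ / 2 := by
    rw [norm_smul, Real.norm_of_nonneg hσ0.le, hσ]; field_simp
  have hn' : 0 < ‖σ • (x - a)‖ := by rw [hn]; positivity
  have hr1 := min_le_left r ρ
  have hr2 := min_le_right r ρ
  have hrr : 0 < min r ρ := by positivity
  have h6 := @h5 (σ • (x - a)) (by rw [dist_zero_right, hn]; linarith)
  rw [Real.norm_eq_abs] at h6
  have h7 := (abs_le.1 h6).1
  have h8 : (1 - ε / 2) * ‖σ • (x - a)‖ ≤ φ (σ • (x - a)) := by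
    rw [norm_smul, Real.norm_of_nonneg hσ0.le, map_smul, smul_eq_mul]
    nlinarith
  refine ⟨x + σ • (x - a), ?_, ?_, ?_⟩
  · rw [add_sub_cancel_left, hn]; linarith
  · nlinarith
  · rw [add_sub_cancel_left]; linarith

theorem aux_climb {X : Type*} [NormedAddCommGroup X] [NormedSpace ℝ X] [CompleteSpace X]
    {A : Set X} (hA : A.Nonempty) {R : ℝ}
    (hdf : ∀ x, 0 < Metric.infDist x A → Metric.infDist x A < R →
      DifferentiableAt ℝ (fun x => Metric.infDist x A) x)
    {m : X} {t : ℝ} (hm : 0 < Metric.infDist m A) (ht : 0 ≤ t) (hmt : Metric.infDist m A + t < R)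
    {ε : ℝ} (hε : 0 < ε) (hε1 : ε < 1) :
    ∃ y, Metric.infDist y A = Metric.infDist m A + t ∧ (1 - ε) * ‖y - m‖ ≤ t := by
  set f : X → ℝ := fun x => Metric.infDist x A with hf
  have hfc : Continuous f := Metric.continuous_infDist_pt A
  set T := f m + t with hT
  let S : X → Set X := fun x => {y | f y ≤ T ∧ (1 - ε) * ‖y - x‖ ≤ f y - f x}
  have hSself : ∀ x, f x ≤ T → x ∈ S x := fun x hx => ⟨hx, by simp⟩
  have hStrans : ∀ x y z, y ∈ S x → z ∈ S y → z ∈ S x := by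
    intro x y z hy hz
    refine ⟨hz.1, ?_⟩
    have := norm_sub_le_norm_sub_add_norm_sub z y x
    have h1 := hy.2
    have h2 := hz.2
    nlinarith
  have hstep : ∀ x : {x // f x ≤ T}, ∃ y : {x // f x ≤ T}, y.1 ∈ S x ∧
      ∀ z ∈ S x, f z - f x ≤ 2 * (f y - f x) := by
    rintro ⟨x, hx⟩
    have hne : (f '' S x).Nonempty := ⟨_, x, hSself x hx, rfl⟩
    have hbd : BddAbove (f '' S x) := ⟨T, by rintro _ ⟨z, hz, rfl⟩; exact hz.1⟩
    by_cases hs : sSup (f '' S x) ≤ f x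
    · refine ⟨⟨x, hx⟩, hSself x hx, fun z hz => ?_⟩
      have := le_csSup hbd ⟨z, hz, rfl⟩
      simp only; linarith
    · push Not at hs
      obtain ⟨_, ⟨y, hy, rfl⟩, hlt⟩ := exists_lt_of_lt_csSup hne
        (show (sSup (f '' S x) + f x) / 2 < sSup (f '' S x) by linarith)
      refine ⟨⟨y, hy.1⟩, hy, fun z hz => ?_⟩
      have := le_csSup hbd ⟨z, hz, rfl⟩
      simp only; linarith
  choose g hg1 hg2 using hstep
  let u : ℕ → {x // f x ≤ T} := fun n => g^[n] ⟨m, by simp only [hT]; linarith⟩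
  have hu : ∀ n, u (n + 1) = g (u n) := fun n => Function.iterate_succ_apply' _ _ _
  have hmem : ∀ n k, (u (n + k)).1 ∈ S (u n) := by
    intro n k
    induction k with
    | zero => exact hSself _ (u n).2
    | succ k ih => exact hStrans _ _ _ ih (by rw [← add_assoc, hu]; exact hg1 _)
  have hmono : Monotone (fun n => f (u n)) := by
    refine monotone_nat_of_le_succ fun n => ?_
    have := (hmem n 1).2
    have h0 : 0 ≤ (1 - ε) * ‖(u (n+1)).1 - u n‖ := by
      apply mul_nonneg <;> [linarith; positivity]
    linarith
  have hbd : BddAbove (Set.range fun n => f (u n)) := ⟨T, by rintro _ ⟨n, rfl⟩; exact (u n).2⟩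
  have hlim := tendsto_atTop_ciSup hmono hbd
  have hcau : CauchySeq (fun n => (u n).1) := by
    rw [Metric.cauchySeq_iff']
    intro e he
    obtain ⟨N, hN⟩ := Metric.cauchySeq_iff'.1 hlim.cauchySeq ((1 - ε) * e)
      (by apply mul_pos <;> linarith)
    refine ⟨N, fun n hn => ?_⟩
    obtain ⟨k, rfl⟩ := Nat.exists_eq_add_of_le hn
    have h1 := (hmem N k).2
    have h2 := hN _ hn
    rw [Real.dist_eq] at h2
    have h3 := (abs_lt.1 h2).2
    rw [dist_eq_norm]
    have : (1 - ε) * ‖(u (N + k)).1 - u N‖ < (1 - ε) * e := by linarith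
    exact lt_of_mul_lt_mul_left this (by linarith)
  obtain ⟨y, hy⟩ := cauchySeq_tendsto_of_complete hcau
  have hfy : Filter.Tendsto (fun n => f (u n)) Filter.atTop (nhds (f y)) :=
    (hfc.tendsto y).comp hy
  have hyT : f y ≤ T := le_of_tendsto' hfy fun n => (u n).2
  have hyS : ∀ n, y ∈ S (u n) := by
    intro n
    refine ⟨hyT, ?_⟩
    have hh : ∀ᶠ k in Filter.atTop, (1 - ε) * ‖(u k).1 - u n‖ ≤ f (u k) - f (u n) := by
      filter_upwards [Filter.eventually_ge_atTop n] with k hk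
      obtain ⟨j, rfl⟩ := Nat.exists_eq_add_of_le hk
      exact (hmem n j).2
    refine le_of_tendsto_of_tendsto ?_ (hfy.sub_const _) hh
    exact ((hy.sub_const _).norm).const_mul _
  have hym : (1 - ε) * ‖y - m‖ ≤ f y - f m := (hyS 0).2
  have hmy : f m ≤ f y := by
    have : 0 ≤ (1 - ε) * ‖y - m‖ := by apply mul_nonneg <;> [linarith; positivity]
    linarith
  have hEq : f y = T := by
    by_contra hne
    have hlt : f y < T := lt_of_le_of_ne hyT hne
    obtain ⟨z, hz1, hz2, hz3⟩ := aux_ascent hA (hdf y (lt_of_lt_of_le hm hmy) (by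
      change f y < R; linarith)) (lt_of_lt_of_le hm hmy) hε hε1
      (r := T - f y) (by linarith)
    have hzS : z ∈ S y := by
      refine ⟨?_, hz3⟩
      have h1 : Metric.infDist z A ≤ Metric.infDist y A + dist z y := Metric.infDist_le_infDist_add_dist
      rw [dist_eq_norm] at h1
      change Metric.infDist z A ≤ T
      have : Metric.infDist y A = f y := rfl
      linarith
    have hk : ∀ n, f z - f (u n) ≤ 2 * (f (u (n+1)) - f (u n)) := by
      intro n
      rw [hu]
      exact hg2 (u n) z (hStrans _ _ _ (hyS n) hzS)
    have := le_of_tendsto_of_tendsto' (hfy.const_sub (f z))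
      (((hfy.comp (Filter.tendsto_add_atTop_nat 1)).sub hfy).const_mul 2) hk
    have h2 : f y < f z := hz2
    linarith
  refine ⟨y, hEq, ?_⟩
  rw [hEq] at hym
  linarith

theorem aux_smooth {X : Type*} [NormedAddCommGroup X] [NormedSpace ℝ X] (w h : X) (hw : w ≠ 0) :
    ‖w + h‖ + ‖w - h‖ ≤ 2 * ‖w‖ * (1 + modSmooth X (‖h‖ / ‖w‖)) := by
  have hW : 0 < ‖w‖ := norm_pos_iff.2 hw
  have key : (‖‖w‖⁻¹ • w + ‖w‖⁻¹ • h‖ + ‖‖w‖⁻¹ • w - ‖w‖⁻¹ • h‖) / 2 - 1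
      ≤ modSmooth X (‖h‖ / ‖w‖) := by
    apply le_csSup
    · refine ⟨‖h‖ / ‖w‖, ?_⟩
      rintro _ ⟨x, y, hx, hy, rfl⟩
      have := norm_add_le x y
      have := norm_sub_le x y
      linarith
    · refine ⟨_, _, ?_, ?_, rfl⟩
      · rw [norm_smul, norm_inv, norm_norm]; field_simp
      · rw [norm_smul, norm_inv, norm_norm]; field_simp
  rw [← smul_add, ← smul_sub, norm_smul, norm_smul, norm_inv, norm_norm] at key
  have e : (‖w‖⁻¹ * ‖w + h‖ + ‖w‖⁻¹ * ‖w - h‖) / 2 - 1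
    = (‖w + h‖ + ‖w - h‖) / (2 * ‖w‖) - 1 := by field_simp
  rw [e, sub_le_iff_le_add, div_le_iff₀ (by positivity)] at key
  linarith

theorem aux_mid {X : Type*} [NormedAddCommGroup X] [NormedSpace ℝ X] [CompleteSpace X]
    {s C : ℝ} (hs : 1 < s) (hC : ∀ τ : ℝ, 0 ≤ τ → modSmooth X τ ≤ C * τ ^ s)
    {A : Set X} (hcl : IsClosed A) {R : ℝ} (hR : 0 < R)
    (hdf : ∀ x, 0 < Metric.infDist x A → Metric.infDist x A < R →
      DifferentiableAt ℝ (fun x => Metric.infDist x A) x) :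
    ∃ K, 0 ≤ K ∧ ∃ δ > 0, ∀ u ∈ A, ∀ v ∈ A, ‖u - v‖ ≤ δ →
      ∃ z ∈ A, ‖z - u‖ ≤ ‖u - v‖ / 2 + K * ‖u - v‖ ^ s ∧
        ‖z - v‖ ≤ ‖u - v‖ / 2 + K * ‖u - v‖ ^ s := by
  set t := R / 2 with ht
  have ht0 : 0 < t := by positivity
  refine ⟨2 * (2 * |C| * t * (1 / t) ^ s), by positivity, R / 4, by positivity, ?_⟩
  intro u hu v hv huv
  have hA : A.Nonempty := ⟨u, hu⟩
  set m : X := (1/2 : ℝ) • (u + v) with hm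
  set h : X := (1/2 : ℝ) • (u - v) with hh
  have hH : ‖h‖ = ‖u - v‖ / 2 := by rw [hh, norm_smul]; norm_num; ring
  have hmu : m - u = -h := by rw [hm, hh]; module
  have hmv : m - v = h := by rw [hm, hh]; module
  have hd0 : Metric.infDist m A ≤ ‖h‖ := by
    have := Metric.infDist_le_dist_of_mem (x := m) hv
    rwa [dist_eq_norm, hmv] at this
  have hdb : Metric.infDist m A ≤ 2 * |C| * t * (1 / t) ^ s * ‖u - v‖ ^ s := by
    by_cases hpos : 0 < Metric.infDist m A
    swap
    · push Not at hpos
      exact hpos.trans (by positivity)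
    have hsm : ∀ e : ℝ, 0 < e → e ≤ 1 / 2 → Metric.infDist m A ≤
        2 * |C| * t * (1 / t) ^ s * ‖u - v‖ ^ s + 2 * t * e := by
      intro e he he2
      obtain ⟨y, hy1, hy2⟩ := aux_climb hA hdf hpos ht0.le (by linarith [norm_nonneg (u - v)]) he
        (by linarith)
      set w := y - m with hw
      have hWt : t ≤ ‖w‖ := by
        have : Metric.infDist y A ≤ Metric.infDist m A + dist y m :=
          Metric.infDist_le_infDist_add_dist
        rw [dist_eq_norm] at this
        linarith
      have hW0 : 0 < ‖w‖ := by linarith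
      have hW2 : ‖w‖ ≤ t + 2 * t * e := by nlinarith
      have hW3 : ‖w‖ ≤ 2 * t := by nlinarith
      have hyu : Metric.infDist y A ≤ ‖w - h‖ := by
        have := Metric.infDist_le_dist_of_mem (x := y) hu
        rw [dist_eq_norm] at this
        have e : y - u = w - h := by rw [hw, sub_sub, sub_eq_add_neg, sub_eq_add_neg y, add_right_inj, neg_inj,
          ← sub_eq_iff_eq_add', ← neg_sub, hmu, neg_neg]
        rwa [e] at this
      have hyv : Metric.infDist y A ≤ ‖w + h‖ := by
        have := Metric.infDist_le_dist_of_mem (x := y) hv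
        rw [dist_eq_norm] at this
        have e : y - v = w + h := by rw [hw, ← hmv]; abel
        rwa [e] at this
      have h1 := aux_smooth w h (norm_pos_iff.1 hW0)
      have h2 := hC (‖h‖ / ‖w‖) (by positivity)
      have h3 : C * (‖h‖ / ‖w‖) ^ s ≤ |C| * (‖u - v‖ * (1 / t)) ^ s := by
        have : ‖h‖ / ‖w‖ ≤ ‖u - v‖ * (1 / t) := by
          rw [mul_one_div]
          gcongr
          rw [hH]; linarith [norm_nonneg (u - v)]
        gcongr
        exact le_abs_self C
      rw [Real.mul_rpow (norm_nonneg _) (by positivity)] at h3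
      have h4 : ‖w‖ * modSmooth X (‖h‖ / ‖w‖) ≤
          (2 * t) * (|C| * (‖u - v‖ ^ s * (1 / t) ^ s)) := by
        calc _ ≤ ‖w‖ * (|C| * (‖u - v‖ ^ s * (1 / t) ^ s)) := by gcongr; linarith
          _ ≤ _ := by gcongr
      nlinarith
    refine le_of_forall_pos_le_add fun e he => ?_
    have := hsm (min (1/2) (e / (2 * t))) (by positivity) (min_le_left _ _)
    have h2 : 2 * t * min (1/2) (e / (2 * t)) ≤ e := by
      calc _ ≤ 2 * t * (e / (2 * t)) := by gcongr; exact min_le_right _ _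
        _ = e := by field_simp
    linarith
  obtain ⟨z, hz, hzm⟩ : ∃ z ∈ A, ‖z - m‖ ≤ 2 * Metric.infDist m A := by
    by_cases hpos : 0 < Metric.infDist m A
    · obtain ⟨z, hz, hzm⟩ := (Metric.infDist_lt_iff (x := m) (r := 2 * Metric.infDist m A) hA).1
        (by linarith)
      rw [dist_comm, dist_eq_norm] at hzm
      exact ⟨z, hz, hzm.le⟩
    · have : Metric.infDist m A = 0 := le_antisymm (not_lt.1 hpos) Metric.infDist_nonneg
      exact ⟨m, (hcl.mem_iff_infDist_zero hA).2 this, by simp [this]⟩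
  refine ⟨z, hz, ?_, ?_⟩
  · have := norm_sub_le_norm_sub_add_norm_sub z m u
    rw [hmu, norm_neg, hH] at this
    linarith
  · have := norm_sub_le_norm_sub_add_norm_sub z m v
    rw [hmv, hH] at this
    linarith

theorem aux_near {X : Type*} [NormedAddCommGroup X] [NormedSpace ℝ X] [UniformConvexSpace X]
    {A : Set X} (hcl : IsClosed A) (hA : A.Nonempty) {R : ℝ}
    (hdf : ∀ x, 0 < Metric.infDist x A → Metric.infDist x A < R →
      DifferentiableAt ℝ (fun x => Metric.infDist x A) x)
    (x : X) (hx : Metric.infDist x A < R) {ε : ℝ} (hε : 0 < ε) :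
    ∃ η > 0, ∀ a ∈ A, ∀ b ∈ A, ‖x - a‖ ≤ Metric.infDist x A + η →
      ‖x - b‖ ≤ Metric.infDist x A + η → ‖a - b‖ < ε := by
  rcases (Metric.infDist_nonneg (x := x) (s := A)).eq_or_lt with h0 | hpos
  · refine ⟨ε / 3, by positivity, fun a _ b _ ha hb => ?_⟩
    rw [← h0] at ha hb
    have := norm_sub_le_norm_sub_add_norm_sub a x b
    rw [norm_sub_rev a x] at this
    linarith
  have hφ := (hdf x hpos hx).hasFDerivAt
  have hn : ‖fderiv ℝ (fun x => Metric.infDist x A) x‖ ≤ 1 := by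
    simpa using norm_fderiv_le_of_lipschitz ℝ (x₀ := x) (Metric.lipschitz_infDist_pt A)
  set φ := fderiv ℝ (fun x => Metric.infDist x A) x
  set d := Metric.infDist x A with hd
  obtain ⟨δ, hδ, h1⟩ := exists_forall_closed_ball_dist_add_le_two_mul_sub X (half_pos hε) d
  obtain ⟨η₁, hη₁, h2⟩ := aux_slope hφ (ε := δ / 8) (by positivity)
  set η := min η₁ (min (δ / 8) (ε / 8))
  have e1 : η ≤ η₁ := min_le_left _ _
  have e2 : η ≤ δ / 8 := (min_le_right _ _).trans (min_le_left _ _)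
  have e3 : η ≤ ε / 8 := (min_le_right _ _).trans (min_le_right _ _)
  have e0 : 0 < η := by positivity
  refine ⟨η, e0, fun a haA b hbA ha hb => ?_⟩
  by_contra hcon
  push Not at hcon
  set c := d / (d + η) with hc
  have hc0 : 0 ≤ c := by positivity
  have hc1 : c ≤ 1 := by rw [hc, div_le_one (by positivity)]; linarith
  have hsc : ∀ y : X, ‖y‖ ≤ d + η → ‖c • y‖ ≤ d ∧ ‖y - c • y‖ ≤ η := by
    intro y hy
    constructor
    · rw [norm_smul, Real.norm_of_nonneg hc0]
      calc _ ≤ c * (d + η) := by gcongr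
        _ = d := by rw [hc]; field_simp
    · have : y - c • y = (1 - c) • y := by module
      rw [this, norm_smul, Real.norm_of_nonneg (by linarith)]
      calc _ ≤ (1 - c) * (d + η) := by
            apply mul_le_mul_of_nonneg_left hy; linarith
        _ = η := by rw [hc]; field_simp; ring
  obtain ⟨p1, p2⟩ := hsc _ ha
  obtain ⟨q1, q2⟩ := hsc _ hb
  have h3 := h1 p1 q1 (by
    have t1 : ‖a - b‖ ≤ ‖c • (x - a) - c • (x - b)‖ + ‖(x - b) - c • (x - b)‖ + ‖(x - a) - c • (x - a)‖ := by
      have e : a - b = -(c • (x - a) - c • (x - b)) + ((x - b) - c • (x - b)) - ((x - a) - c • (x - a)) := by module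
      rw [e]
      refine (norm_sub_le _ _).trans ?_
      gcongr
      refine (norm_add_le _ _).trans ?_
      rw [norm_neg]
    linarith)
  have t2 : ‖(x - a) + (x - b)‖ ≤ ‖c • (x - a) + c • (x - b)‖ + ‖(x - b) - c • (x - b)‖ + ‖(x - a) - c • (x - a)‖ := by
      have e : (x - a) + (x - b) = (c • (x - a) + c • (x - b)) + ((x - b) - c • (x - b)) + ((x - a) - c • (x - a)) := by module
      rw [e]
      refine (norm_add_le _ _).trans ?_
      gcongr
      exact (norm_add_le _ _)
  have h4 := h2 a haA (by linarith)
  have h5 := h2 b hbA (by linarith)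
  have h6 : φ ((x - a) + (x - b)) ≤ ‖(x - a) + (x - b)‖ := by
    have := φ.le_of_opNorm_le hn ((x - a) + (x - b))
    rw [one_mul] at this
    exact (le_abs_self _).trans this
  rw [map_add] at h6
  linarith

theorem aux_proj {X : Type*} [NormedAddCommGroup X] [NormedSpace ℝ X] [UniformConvexSpace X]
    [CompleteSpace X]
    {A : Set X} (hcl : IsClosed A) (hA : A.Nonempty) {R : ℝ}
    (hdf : ∀ x, 0 < Metric.infDist x A → Metric.infDist x A < R →
      DifferentiableAt ℝ (fun x => Metric.infDist x A) x) :
    ∃ P : X → X, (∀ x, Metric.infDist x A < R → P x ∈ A ∧ ‖x - P x‖ = Metric.infDist x A) ∧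
      ContinuousOn P {x | Metric.infDist x A < R} := by
  have hex : ∀ x, ∃ p, Metric.infDist x A < R → p ∈ A ∧ ‖x - p‖ = Metric.infDist x A := by
    intro x
    by_cases hx : Metric.infDist x A < R
    swap
    · exact ⟨x, fun h => absurd h hx⟩
    have : ∀ n : ℕ, ∃ a ∈ A, ‖x - a‖ < Metric.infDist x A + 1 / ((n : ℝ) + 1) := by
      intro n
      have : (0:ℝ) < 1 / ((n : ℝ) + 1) := by positivity
      obtain ⟨a, ha, h⟩ := (Metric.infDist_lt_iff (x := x)
        (r := Metric.infDist x A + 1 / ((n : ℝ) + 1)) hA).1 (by linarith)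
      exact ⟨a, ha, by rwa [← dist_eq_norm]⟩
    choose a haA ha using this
    have hlim : Filter.Tendsto (fun n : ℕ => 1 / ((n : ℝ) + 1)) Filter.atTop (nhds 0) :=
      tendsto_one_div_add_atTop_nhds_zero_nat
    have hc : CauchySeq a := by
      rw [Metric.cauchySeq_iff]
      intro ε hε
      obtain ⟨η, hη, h⟩ := aux_near hcl hA hdf x hx hε
      obtain ⟨N, hN⟩ := Filter.eventually_atTop.1 (hlim.eventually (gt_mem_nhds hη))
      refine ⟨N, fun m hm n hn => ?_⟩
      rw [dist_eq_norm]
      have := hN m hm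
      have := hN n hn
      have := ha m
      have := ha n
      exact h _ (haA m) _ (haA n) (by linarith) (by linarith)
    obtain ⟨p, hp⟩ := cauchySeq_tendsto_of_complete hc
    have hpA : p ∈ A := hcl.mem_of_tendsto hp (Filter.Eventually.of_forall haA)
    refine ⟨p, fun _ => ⟨hpA, le_antisymm ?_ ?_⟩⟩
    · have := le_of_tendsto_of_tendsto' (hp.const_sub x).norm (hlim.const_add (Metric.infDist x A))
        (fun n => (ha n).le)
      simpa using this
    · rw [← dist_eq_norm]
      exact Metric.infDist_le_dist_of_mem hpA
  choose P hP using hex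
  refine ⟨P, hP, ?_⟩
  intro x hx
  rw [Metric.continuousWithinAt_iff]
  intro ε hε
  obtain ⟨η, hη, h⟩ := aux_near hcl hA hdf x hx hε
  refine ⟨η / 2, by positivity, fun y hy hyx => ?_⟩
  rw [dist_eq_norm]
  refine h _ (hP y hy).1 _ (hP x hx).1 ?_ ?_
  · have h1 := norm_sub_le_norm_sub_add_norm_sub x y (P y)
    rw [(hP y hy).2] at h1
    have h2 : Metric.infDist y A ≤ Metric.infDist x A + dist y x :=
      Metric.infDist_le_infDist_add_dist
    rw [dist_eq_norm, norm_sub_rev] at h2 hyx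
    linarith
  · rw [(hP x hx).2]; linarith

theorem aux_seq {s K : ℝ} (hs : 1 < s) (hK : 0 ≤ K) {L : ℕ → ℝ} (hL0 : 0 < L 0)
    (hL : ∀ n, L (n + 1) = L n / 2 + K * L n ^ s) (hsmall : 2 * K * L 0 ^ (s - 1) ≤ 1 / 2) :
    ∃ M, 0 ≤ M ∧ ∀ n, 0 < L n ∧ L n ≤ L 0 ∧ L n ≤ M * (1 / 2) ^ n := by
  set θ : ℝ := (3 / 4 : ℝ) ^ (s - 1) with hθ
  have hθ0 : 0 < θ := by positivity
  have hθ1 : θ < 1 := Real.rpow_lt_one (by norm_num) (by norm_num) (by linarith)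
  have hpow : ∀ l : ℝ, 0 < l → l ^ s = l * l ^ (s - 1) := by
    intro l hl
    rw [Real.rpow_sub_one hl.ne']; field_simp
  have key : ∀ n, 0 < L n → L n ≤ (3/4) ^ n * L 0 → 2 * K * L n ^ (s - 1) ≤ θ ^ n * (1 / 2) := by
    intro n h1 h2
    have : L n ^ (s - 1) ≤ θ ^ n * L 0 ^ (s - 1) := by
      calc L n ^ (s - 1) ≤ ((3/4) ^ n * L 0) ^ (s - 1) := by gcongr
        _ = _ := by
          rw [Real.mul_rpow (by positivity) hL0.le, hθ, ← Real.rpow_natCast, ← Real.rpow_natCast,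
            ← Real.rpow_mul (by norm_num), ← Real.rpow_mul (by norm_num), mul_comm]
          ring_nf
    calc 2 * K * L n ^ (s - 1) ≤ 2 * K * (θ ^ n * L 0 ^ (s - 1)) := by gcongr
      _ = θ ^ n * (2 * K * L 0 ^ (s - 1)) := by ring
      _ ≤ _ := by gcongr
  have h1 : ∀ n, 0 < L n ∧ L n ≤ (3/4) ^ n * L 0 := by
    intro n
    induction n with
    | zero => exact ⟨hL0, by simp⟩
    | succ n ih =>
      have hk := key n ih.1 ih.2
      have : θ ^ n ≤ 1 := pow_le_one₀ hθ0.le hθ1.le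
      have hp := ih.1
      have h2 : 0 ≤ K * L n ^ s := by positivity
      refine ⟨by rw [hL]; positivity, ?_⟩
      rw [hL, hpow _ hp, pow_succ]
      have : L n * (2 * K * L n ^ (s - 1)) ≤ L n * (1/2) := by gcongr; linarith
      nlinarith [ih.2]
  have h2 : ∀ n, L n ≤ L 0 * Real.exp ((1 - θ ^ n) / (1 - θ)) * (1 / 2) ^ n := by
    intro n
    induction n with
    | zero => simp
    | succ n ih =>
      have hk := key n (h1 n).1 (h1 n).2
      have hp := (h1 n).1
      have hθn : 0 < θ ^ n := by positivity
      have he : (1 - θ ^ (n + 1)) / (1 - θ) = (1 - θ ^ n) / (1 - θ) + θ ^ n := by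
        have : 1 - θ ≠ 0 := by linarith
        field_simp; ring
      have h3 := Real.add_one_le_exp (θ ^ n)
      calc L (n + 1) = L n * ((1 + 2 * K * L n ^ (s - 1)) * (1 / 2)) := by
            rw [hL, hpow _ hp]; ring
        _ ≤ L n * (Real.exp (θ ^ n) * (1 / 2)) := by gcongr; linarith
        _ ≤ (L 0 * Real.exp ((1 - θ ^ n) / (1 - θ)) * (1 / 2) ^ n) * (Real.exp (θ ^ n) * (1 / 2)) := by
            gcongr
        _ = _ := by rw [he, Real.exp_add]; ring
  refine ⟨L 0 * Real.exp (1 / (1 - θ)), by positivity, fun n => ⟨(h1 n).1, ?_, ?_⟩⟩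
  · have : (3/4 : ℝ) ^ n ≤ 1 := pow_le_one₀ (by norm_num) (by norm_num)
    nlinarith [(h1 n).2]
  · refine (h2 n).trans ?_
    have : 0 < 1 - θ := by linarith
    gcongr
    have : 0 < θ ^ n := by positivity
    linarith

theorem aux_curve {X : Type*} [NormedAddCommGroup X] [NormedSpace ℝ X] [CompleteSpace X]
    {A : Set X} (hcl : IsClosed A) {L : ℕ → ℝ} {M : ℝ} (hM : 0 ≤ M)
    (hLM : ∀ n, L n ≤ M * (1 / 2) ^ n)
    (hmid : ∀ n, ∀ u ∈ A, ∀ v ∈ A, ‖u - v‖ ≤ L n →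
      ∃ z ∈ A, ‖z - u‖ ≤ L (n + 1) ∧ ‖z - v‖ ≤ L (n + 1))
    (c : ℕ → X) (hcA : ∀ k, c k ∈ A) (hc : ∀ k, ‖c k - c (k + 1)‖ ≤ L 0) :
    ∃ F : ℝ → X, (∀ t, 0 ≤ t → F t ∈ A) ∧ (∀ k : ℕ, F k = c k) ∧
      ∀ t u, 0 ≤ t → t ≤ u → ‖F u - F t‖ ≤ M * (u - t) := by
  have hmid' : ∀ n u v, ∃ z, u ∈ A → v ∈ A → ‖u - v‖ ≤ L n →
      z ∈ A ∧ ‖z - u‖ ≤ L (n + 1) ∧ ‖z - v‖ ≤ L (n + 1) := by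
    intro n u v
    by_cases h : u ∈ A ∧ v ∈ A ∧ ‖u - v‖ ≤ L n
    · obtain ⟨z, hz⟩ := hmid n u h.1 v h.2.1 h.2.2
      exact ⟨z, fun _ _ _ => hz⟩
    · exact ⟨u, fun h1 h2 h3 => absurd ⟨h1, h2, h3⟩ h⟩
  choose Z hZ using hmid'
  let g : ℕ → ℕ → X := fun n => Nat.rec c
    (fun n gn k => if k % 2 = 0 then gn (k / 2) else Z n (gn (k / 2)) (gn (k / 2 + 1))) n
  have hg0 : g 0 = c := rfl
  have hgs : ∀ n k, g (n + 1) k = if k % 2 = 0 then g n (k / 2) else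
      Z n (g n (k / 2)) (g n (k / 2 + 1)) := fun n k => rfl
  have hinv : ∀ n, (∀ k, g n k ∈ A) ∧ ∀ k, ‖g n k - g n (k + 1)‖ ≤ L n := by
    intro n
    induction n with
    | zero => exact ⟨hcA, hc⟩
    | succ n ih =>
      obtain ⟨i1, i2⟩ := ih
      have hz := fun k => hZ n (g n k) (g n (k + 1)) (i1 _) (i1 _) (i2 _)
      refine ⟨fun k => ?_, fun k => ?_⟩
      · rw [hgs]
        split_ifs
        · exact i1 _
        · exact (hz _).1
      · rw [hgs, hgs]
        rcases Nat.even_or_odd' k with ⟨j, rfl | rfl⟩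
        · have a1 : (2 * j) % 2 = 0 := by omega
          have a2 : ¬ (2 * j + 1) % 2 = 0 := by omega
          have a3 : 2 * j / 2 = j := by omega
          have a4 : (2 * j + 1) / 2 = j := by omega
          rw [if_pos a1, if_neg a2, a3, a4, norm_sub_rev]
          exact (hz j).2.1
        · have a1 : (2 * j + 1 + 1) % 2 = 0 := by omega
          have a2 : ¬ (2 * j + 1) % 2 = 0 := by omega
          have a3 : (2 * j + 1 + 1) / 2 = j + 1 := by omega
          have a4 : (2 * j + 1) / 2 = j := by omega
          rw [if_pos a1, if_neg a2, a3, a4]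
          exact (hz j).2.2
  have hgd : ∀ n i j, ‖g n (i + j) - g n i‖ ≤ j * L n := by
    intro n i j
    induction j with
    | zero => simp
    | succ j ih =>
      have h1 := norm_sub_le_norm_sub_add_norm_sub (g n (i + (j + 1))) (g n (i + j)) (g n i)
      have h2 := (hinv n).2 (i + j)
      rw [norm_sub_rev, add_assoc] at h2
      push_cast
      linarith
  have hL0 : ∀ n, 0 ≤ L n := fun n => (norm_nonneg _).trans ((hinv n).2 0)
  let f : ℕ → ℝ → X := fun n t => g n ⌊2 ^ n * t⌋₊
  have hfl : ∀ n (t : ℝ), ⌊2 ^ (n + 1) * t⌋₊ / 2 = ⌊2 ^ n * t⌋₊ := by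
    intro n t
    have := Nat.floor_div_natCast (2 ^ (n + 1) * t : ℝ) 2
    rw [← this]
    congr 1
    push_cast
    ring
  have hstep : ∀ t n, dist (f n t) (f (n + 1) t) ≤ M * (1 / 2) ^ n := by
    intro t n
    change dist (g n _) (g (n + 1) _) ≤ _
    have hM2 : M * (1/2 : ℝ) ^ (n + 1) ≤ M * (1 / 2) ^ n := by
      rw [pow_succ]
      have : 0 ≤ M * (1/2 : ℝ) ^ n := by positivity
      linarith
    rw [hgs, hfl]
    split_ifs
    · rw [dist_self]; positivity
    · have := (hZ n (g n ⌊2 ^ n * t⌋₊) (g n (⌊2 ^ n * t⌋₊ + 1)) ((hinv n).1 _) ((hinv n).1 _)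
        ((hinv n).2 _)).2.1
      rw [dist_comm, dist_eq_norm]
      exact this.trans ((hLM _).trans hM2)
  have hlim : ∀ t, ∃ y, Filter.Tendsto (fun n => f n t) Filter.atTop (nhds y) := fun t =>
    cauchySeq_tendsto_of_complete (cauchySeq_of_le_geometric (1/2) M (by norm_num) (hstep t))
  choose F hF using hlim
  refine ⟨F, fun t _ => hcl.mem_of_tendsto (hF t) (Filter.Eventually.of_forall fun n =>
    (hinv n).1 _), fun k => ?_, fun t u ht htu => ?_⟩
  · have : ∀ n, f n k = c k := by
      intro n
      have e : ⌊(2:ℝ) ^ n * k⌋₊ = 2 ^ n * k := by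
        have : ((2:ℝ) ^ n * k) = ((2 ^ n * k : ℕ) : ℝ) := by push_cast; rfl
        rw [this, Nat.floor_natCast]
      change g n ⌊(2:ℝ) ^ n * k⌋₊ = c k
      rw [e]
      clear e
      induction n with
      | zero => simp [hg0]
      | succ n ih =>
        have a1 : 2 ^ (n + 1) * k = 2 * (2 ^ n * k) := by ring
        rw [hgs, a1, if_pos (by omega), Nat.mul_div_cancel_left _ (by norm_num), ih]
    refine tendsto_nhds_unique (hF k) ?_
    simp only [this]
    exact tendsto_const_nhds
  · have hb : ∀ n, ‖f n u - f n t‖ ≤ M * (u - t) + M * (1 / 2) ^ n := by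
      intro n
      have h2n : (0:ℝ) < 2 ^ n := by positivity
      have hle : ⌊2 ^ n * t⌋₊ ≤ ⌊2 ^ n * u⌋₊ := Nat.floor_mono (by gcongr)
      obtain ⟨j, hj⟩ := Nat.exists_eq_add_of_le hle
      have h1 := hgd n ⌊2 ^ n * t⌋₊ j
      rw [← hj] at h1
      have h3 : (j : ℝ) ≤ 2 ^ n * (u - t) + 1 := by
        have a1 : (⌊2 ^ n * u⌋₊ : ℝ) ≤ 2 ^ n * u := Nat.floor_le (mul_nonneg h2n.le (ht.trans htu))
        have a2 := Nat.lt_floor_add_one (2 ^ n * t : ℝ)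
        rw [hj] at a1
        push_cast at a1
        linarith
      have hut : 0 ≤ u - t := by linarith
      calc _ ≤ j * L n := h1
        _ ≤ (2 ^ n * (u - t) + 1) * (M * (1 / 2) ^ n) := by
            have := hL0 n
            have := hLM n
            gcongr
        _ = M * (u - t) * (2 ^ n * (1 / 2) ^ n) + M * (1 / 2) ^ n := by ring
        _ = _ := by rw [← mul_pow]; norm_num
    have hz : Filter.Tendsto (fun n : ℕ => M * (u - t) + M * (1 / 2 : ℝ) ^ n) Filter.atTop
        (nhds (M * (u - t) + M * 0)) :=
      ((tendsto_pow_atTop_nhds_zero_of_lt_one (by norm_num) (by norm_num)).const_mul M).const_add _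
    have := le_of_tendsto_of_tendsto' ((hF u).sub (hF t)).norm hz hb
    linarith

theorem statement14 (X : Type*) [NormedAddCommGroup X] [NormedSpace ℝ X]
    [CompleteSpace X] [UniformConvexSpace X] (hsm : UnifSmooth X)
    (hpowsm : ∃ s C : ℝ, 1 < s ∧ s ≤ 2 ∧ ∀ τ : ℝ, 0 ≤ τ → modSmooth X τ ≤ C * τ ^ s)
    (hpowcv : ∃ q Ccv : ℝ, 0 < Ccv ∧
      ∀ ε : ℝ, 0 ≤ ε → ε < 2 → Ccv * ε ^ q ≤ modConvex X ε)
    (A : Set X) (R : ℝ) (hR : 0 < R) (hA : ProximallySmooth A R)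
    (x0 x1 : X) (h0 : x0 ∈ A) (h1 : x1 ∈ A) (hd : ‖x0 - x1‖ / R < 2) :
    ∃ f : ℝ → X, IsCurveIn A x0 x1 f ∧ BoundedVariationOn f (Set.Icc 0 1) := by
  obtain ⟨s, C, hs, -, hC⟩ := hpowsm
  obtain ⟨hcl, hcd⟩ := hA
  have hne : A.Nonempty := ⟨x0, h0⟩
  have hcont : Continuous (fun x => Metric.infDist x A) := Metric.continuous_infDist_pt A
  have hdf : ∀ x, 0 < Metric.infDist x A → Metric.infDist x A < R →
      DifferentiableAt ℝ (fun x => Metric.infDist x A) x := by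
    intro x hx hx'
    have ho : IsOpen {x : X | 0 < Metric.infDist x A ∧ Metric.infDist x A < R} :=
      (isOpen_lt continuous_const hcont).inter (isOpen_lt hcont continuous_const)
    exact (hcd.differentiableOn (by norm_num)).differentiableAt (ho.mem_nhds ⟨hx, hx'⟩)
  obtain ⟨K, hK, δ, hδ, hmid⟩ := aux_mid hs hC hcl hR hdf
  obtain ⟨P, hP, hPc⟩ := aux_proj hcl hne hdf
  -- small initial scale
  obtain ⟨l, hl0, hlδ, hlK⟩ : ∃ l : ℝ, 0 < l ∧ l ≤ δ ∧ 2 * K * l ^ (s - 1) ≤ 1 / 2 := by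
    have ht : Filter.Tendsto (fun l : ℝ => 2 * K * l ^ (s - 1)) (nhds 0) (nhds (2 * K * 0 ^ (s - 1))) :=
      (Real.continuousAt_rpow_const 0 (s - 1) (Or.inr (by linarith))).tendsto.const_mul _
    rw [Real.zero_rpow (by linarith), mul_zero] at ht
    have e1 := ht.eventually (ge_mem_nhds (show (0:ℝ) < 1 / 2 by norm_num))
    obtain ⟨r, hr, h⟩ := Metric.eventually_nhds_iff.1 e1
    refine ⟨min δ (r / 2), by positivity, min_le_left _ _, h ?_⟩
    rw [Real.dist_eq, sub_zero, abs_of_pos (by positivity)]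
    have := min_le_right δ (r / 2)
    linarith
  let L : ℕ → ℝ := fun n => Nat.rec l (fun _ a => a / 2 + K * a ^ s) n
  have hL0 : L 0 = l := rfl
  have hLs : ∀ n, L (n + 1) = L n / 2 + K * L n ^ s := fun n => rfl
  obtain ⟨M, hM, hLM⟩ := aux_seq hs hK (L := L) hl0 hLs hlK
  -- the projected segment
  let γ : ℝ → X := fun t => x0 + t • (x1 - x0)
  have hγt : ∀ t ∈ Set.Icc (0:ℝ) 1, Metric.infDist (γ t) A < R := by
    intro t ht
    have hd' : ‖x0 - x1‖ < 2 * R := by rwa [div_lt_iff₀ hR] at hd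
    have a0 : Metric.infDist (γ t) A ≤ t * ‖x0 - x1‖ := by
      have := Metric.infDist_le_dist_of_mem (x := γ t) h0
      have e : γ t - x0 = t • (x1 - x0) := by simp [γ]
      rwa [dist_eq_norm, e, norm_smul, Real.norm_of_nonneg ht.1, norm_sub_rev] at this
    have a1 : Metric.infDist (γ t) A ≤ (1 - t) * ‖x0 - x1‖ := by
      have := Metric.infDist_le_dist_of_mem (x := γ t) h1
      have e : γ t - x1 = (1 - t) • (x0 - x1) := by simp only [γ]; module
      rwa [dist_eq_norm, e, norm_smul, Real.norm_of_nonneg (by linarith [ht.2])] at this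
    linarith
  have hPγ : ContinuousOn (fun t => P (γ t)) (Set.Icc 0 1) :=
    hPc.comp (by fun_prop) hγt
  have hPA : ∀ x ∈ A, P x = x := by
    intro x hx
    have hz : Metric.infDist x A = 0 := Metric.infDist_zero_of_mem hx
    have := (hP x (by rw [hz]; exact hR)).2
    rw [hz, norm_eq_zero, sub_eq_zero] at this
    exact this.symm
  obtain ⟨δ', hδ', huc⟩ := Metric.uniformContinuousOn_iff.1
    (isCompact_Icc.uniformContinuousOn_of_continuous hPγ) l hl0
  obtain ⟨n, hn⟩ := exists_nat_one_div_lt hδ'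
  set N : ℝ := (n : ℝ) + 1 with hN
  have hN0 : 0 < N := by positivity
  let c : ℕ → X := fun k => P (γ (min ((k : ℝ) / N) 1))
  have hmem : ∀ k : ℕ, min ((k : ℝ) / N) 1 ∈ Set.Icc (0:ℝ) 1 := fun k =>
    ⟨by positivity, min_le_right _ _⟩
  have hcc : ∀ k, ‖c k - c (k + 1)‖ ≤ L 0 := by
    intro k
    rw [← dist_eq_norm]
    refine (huc _ (hmem k) _ (hmem (k + 1)) ?_).le
    refine lt_of_le_of_lt ?_ hn
    rw [Real.dist_eq]
    refine (abs_min_sub_min_le_max _ _ _ _).trans ?_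
    rw [sub_self, abs_zero]
    refine max_le ?_ (by positivity)
    push_cast
    rw [← sub_div, sub_add_cancel_left, abs_div, abs_neg, abs_one, abs_of_pos hN0]
  obtain ⟨F, hFA, hFc, hFl⟩ := aux_curve hcl hM (fun n => (hLM n).2.2) (by
    intro n u hu v hv huv
    have hln := (hLM n).2.1
    obtain ⟨z, hz, z1, z2⟩ := hmid u hu v hv (by rw [hL0] at hln; linarith)
    have : ‖u - v‖ / 2 + K * ‖u - v‖ ^ s ≤ L (n + 1) := by
      rw [hLs]
      gcongr
    exact ⟨z, hz, z1.trans this, z2.trans this⟩) c (fun k => (hP _ (hγt _ (hmem k))).1) hcc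
  have hlip : LipschitzOnWith (Real.toNNReal (M * N)) (fun t => F (N * t)) (Set.Icc 0 1) := by
    apply LipschitzOnWith.of_dist_le_mul
    have hmain : ∀ a b : ℝ, 0 ≤ a → a ≤ b → dist (F (N * a)) (F (N * b)) ≤ M * N * dist a b := by
      intro a b ha hab
      have := hFl (N * a) (N * b) (by positivity) (by gcongr)
      rw [dist_comm, dist_eq_norm, Real.dist_eq, abs_sub_comm, abs_of_nonneg (by linarith)]
      linarith
    intro a ha b hb
    rw [Real.coe_toNNReal _ (by positivity)]
    rcases le_total a b with h | h
    · exact hmain a b ha.1 h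
    · rw [dist_comm, dist_comm a b]
      exact hmain b a hb.1 h
  refine ⟨fun t => F (N * t), ⟨hlip.continuousOn, ?_, ?_, ?_⟩, ?_⟩
  · have := hFc 0
    simp only [Nat.cast_zero] at this
    simp only [mul_zero, this]
    simp [c, γ, hPA x0 h0]
  · have := hFc (n + 1)
    simp only [mul_one]
    push_cast at this
    rw [hN, this]
    have e : ((n + 1 : ℕ) : ℝ) / N = 1 := by rw [hN]; push_cast; field_simp
    simp only [c, e, min_self, γ, one_smul, add_sub_cancel, hPA x1 h1]
  · rintro _ ⟨t, ht, rfl⟩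
    exact hFA _ (mul_nonneg hN0.le ht.1)
  · have := hlip.locallyBoundedVariationOn 0 1 (by simp) (by simp)
    rwa [Set.inter_self] at this
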